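/- arXiv:math/0206275 — 7 statements merged into one kernel-verified Lean document; each statement's English description precedes it below -/
import Mathlib

section
/- Let r ≥ 1 and let p₁ and p₂ be polynomials in r complex variables. Let μ ∈ ℂ^r, and let Λ = {n ∈ ℕ^r : n₁ ≥ n₂ ≥ … ≥ n_r}. If p₁(μ + n) = p₂(μ + n) for every n ∈ Λ, then p₁ = p₂ as polynomials (equivalently, p₁(λ) = p₂(λ) for all λ ∈ ℂ^r). -/
/-- If two polynomials in `r` complex variables agree on the translate by
`μ` of the cone `Λ` of decreasing `r`-tuples of non-negative integers, they are equal. -/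
theorem mvpoly_eq_of_eq_on_shifted_decreasing_cone
    (r : ℕ) (hr : 1 ≤ r) (p₁ p₂ : MvPolynomial (Fin r) ℂ) (μ : Fin r → ℂ)
    (h : ∀ n : Fin r → ℕ, (∀ i j : Fin r, i ≤ j → n j ≤ n i) →
      MvPolynomial.eval (fun i => μ i + (n i : ℂ)) p₁ =
        MvPolynomial.eval (fun i => μ i + (n i : ℂ)) p₂) :
    p₁ = p₂ := by
  classical
  let S : Fin r → MvPolynomial (Fin r) ℂ := fun i =>
    MvPolynomial.C (μ i) + ∑ j : Fin r, if i ≤ j then MvPolynomial.X j else 0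
  have hS : ∀ (x : Fin r → ℂ) (p : MvPolynomial (Fin r) ℂ),
      MvPolynomial.eval x (MvPolynomial.bind₁ S p) =
        MvPolynomial.eval (fun i => μ i + ∑ j : Fin r, if i ≤ j then x j else 0) p := by
    intro x p
    rw [← MvPolynomial.coe_aeval_eq_eval, ← MvPolynomial.coe_aeval_eq_eval]
    simp only [RingHom.coe_coe]
    rw [MvPolynomial.aeval_bind₁]
    congr 2
    funext i
    simp only [S, map_add, map_sum, apply_ite (MvPolynomial.aeval x), MvPolynomial.aeval_X,
      map_zero, MvPolynomial.algHom_C]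
    rfl
  have hq : MvPolynomial.bind₁ S p₁ = MvPolynomial.bind₁ S p₂ := by
    apply MvPolynomial.funext_set (fun _ => Set.range (fun n : ℕ => (n : ℂ)))
      (fun _ => Set.infinite_range_of_injective Nat.cast_injective)
    intro x hx
    have hx' : ∀ i, ∃ n : ℕ, (n : ℂ) = x i := fun i => hx i (Set.mem_univ i)
    choose m hm using hx'
    rw [hS, hS]
    have key := h (fun i => ∑ j : Fin r, if i ≤ j then m j else 0) (by
      intro i j hij
      apply Finset.sum_le_sum
      intro k _
      by_cases hjk : j ≤ k
      · simp [hjk, hij.trans hjk]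
      · simp [hjk])
    simpa [← hm] using key
  apply MvPolynomial.funext
  intro l
  let F : ℕ → ℂ := fun k => if hk : k < r then l ⟨k, hk⟩ - μ ⟨k, hk⟩ else 0
  have hF : (fun i : Fin r => μ i + ∑ j : Fin r,
      if i ≤ j then (F (j : ℕ) - F ((j : ℕ) + 1)) else 0) = l := by
    funext i
    have h1 : (∑ j : Fin r, if i ≤ j then (F (j : ℕ) - F ((j : ℕ) + 1)) else 0)
        = ∑ j ∈ Finset.Ico (i : ℕ) r, (F j - F (j + 1)) := by
      have h2 := Finset.sum_range
        (n := r) (fun j : ℕ => if (i : ℕ) ≤ j then (F j - F (j + 1)) else 0)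
      simp only [Fin.le_def]
      rw [← h2, ← Finset.sum_filter]
      apply Finset.sum_congr _ (fun _ _ => rfl)
      ext j
      simp only [Finset.mem_filter, Finset.mem_range, Finset.mem_Ico]
      tauto
    have h3 : ∑ j ∈ Finset.Ico (i : ℕ) r, (F j - F (j + 1)) = F i - F r := by
      have h4 := Finset.sum_Ico_sub F i.2.le
      rw [← neg_sub (F r), ← h4, ← Finset.sum_neg_distrib]
      simp
    rw [h1, h3]
    simp [F]
  have := congrArg (MvPolynomial.eval (fun j : Fin r => F (j : ℕ) - F ((j : ℕ) + 1))) hq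
  rwa [hS, hS, hF] at this
end

section
/- Let r ≥ 1 be an integer, let a > 0 and ν be real numbers. The function (t₁,…,t_r) ↦ ∏_{j=1}^r cosh(t_j)^{−2ν} · ∏_{1 ≤ i < j ≤ r} sinh(t_i − t_j)^a is integrable over the region {(t₁,…,t_r) ∈ ℝ^r : t₁ > t₂ > … > t_r} with respect to Lebesgue measure if and only if ν > (r−1)a/2. -/
open MeasureTheory Real

lemma aux_prod_pairs (r : ℕ) (f : Fin r → ℝ) :
    ∏ p ∈ Finset.univ.filter (fun p : Fin r × Fin r => p.1 < p.2), (f p.1 * f p.2)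
      = ∏ i, f i ^ (r - 1) := by
  have h1 : ∏ p ∈ Finset.univ.filter (fun p : Fin r × Fin r => p.1 < p.2), f p.2
      = ∏ p ∈ Finset.univ.filter (fun p : Fin r × Fin r => p.2 < p.1), f p.1 := by
    refine Finset.prod_nbij' Prod.swap Prod.swap ?_ ?_ ?_ ?_ ?_ <;> simp
  rw [Finset.prod_mul_distrib, h1, Finset.prod_filter, Finset.prod_filter,
    ← Finset.prod_mul_distrib, Fintype.prod_prod_type]
  refine Finset.prod_congr rfl fun i _ => ?_
  have : ∀ j : Fin r, ((if i < j then f i else 1) * (if j < i then f i else 1))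
      = if j ∈ Finset.univ.erase i then f i else 1 := by
    intro j
    rcases lt_trichotomy i j with h | h | h
    · simp [h, h.ne', not_lt.mpr h.le]
    · simp [h]
    · simp [h, h.ne, not_lt.mpr h.le]
  simp only [this]
  rw [Finset.prod_ite_mem, Finset.univ_inter, Finset.prod_const,
    Finset.card_erase_of_mem (Finset.mem_univ i)]
  simp

lemma aux_measSet (r : ℕ) :
    MeasurableSet {t : Fin r → ℝ | ∀ i j : Fin r, i < j → t j < t i} := by
  have : {t : Fin r → ℝ | ∀ i j : Fin r, i < j → t j < t i}
      = ⋂ i, ⋂ j, ⋂ (_ : i < j), {t : Fin r → ℝ | t j < t i} := by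
    ext t; simp
  rw [this]
  refine MeasurableSet.iInter fun i => MeasurableSet.iInter fun j => MeasurableSet.iInter fun _ => ?_
  exact measurableSet_lt (measurable_pi_apply j) (measurable_pi_apply i)

lemma aux_meas (r : ℕ) (a ν : ℝ) : Measurable (fun t : Fin r → ℝ =>
        (∏ j : Fin r, Real.cosh (t j) ^ (-(2 * ν))) *
        ∏ p ∈ Finset.univ.filter (fun p : Fin r × Fin r => p.1 < p.2),
          Real.sinh (t p.1 - t p.2) ^ a) := by
  refine Measurable.mul ?_ ?_
  · refine Finset.measurable_prod _ fun j _ => ?_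
    exact (Real.measurable_cosh.comp (measurable_pi_apply j)).pow_const _
  · refine Finset.measurable_prod _ fun p _ => ?_
    exact (Real.measurable_sinh.comp
      ((measurable_pi_apply p.1).sub (measurable_pi_apply p.2))).pow_const _

lemma aux_int_exp (c : ℝ) (hc : 0 < c) : Integrable (fun x : ℝ => Real.exp (-c * |x|)) := by
  rw [← integrableOn_univ, ← Set.Iic_union_Ioi (a := (0:ℝ))]
  refine IntegrableOn.union ?_ ?_
  · refine (integrableOn_exp_mul_Iic hc 0).congr_fun (fun x hx => ?_) measurableSet_Iic
    simp only [abs_of_nonpos (Set.mem_Iic.mp hx)]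
    ring_nf
  · refine (integrableOn_exp_mul_Ioi (neg_lt_zero.mpr hc) 0).congr_fun (fun x hx => ?_)
      measurableSet_Ioi
    simp only [abs_of_pos (Set.mem_Ioi.mp hx)]

lemma aux_int_cosh (c : ℝ) (hc : 0 < c) : Integrable (fun x : ℝ => Real.cosh x ^ (-c)) := by
  refine Integrable.mono' ((aux_int_exp c hc).const_mul ((2:ℝ) ^ c))
    (Real.measurable_cosh.pow_const _).aestronglyMeasurable (Filter.Eventually.of_forall fun x => ?_)
  have h1 : Real.exp |x| / 2 ≤ Real.cosh x := by
    rw [← Real.cosh_abs, Real.cosh_eq]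
    have := Real.exp_pos (-|x|)
    linarith
  rw [Real.norm_of_nonneg (Real.rpow_nonneg (Real.cosh_pos x).le _)]
  calc Real.cosh x ^ (-c) ≤ (Real.exp |x| / 2) ^ (-c) :=
        Real.rpow_le_rpow_of_nonpos (by positivity) h1 (by linarith)
    _ = 2 ^ c * Real.exp (-c * |x|) := by
        rw [Real.div_rpow (Real.exp_pos _).le (by norm_num), ← Real.exp_mul,
          Real.rpow_neg (by norm_num : (0:ℝ) ≤ 2), div_inv_eq_mul, mul_comm]
        ring_nf

lemma aux_sinh_le (x y : ℝ) : Real.sinh (x - y) ≤ 2 * (Real.cosh x * Real.cosh y) := by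
  have h := Real.cosh_add x y
  have h2 := Real.cosh_sub x y
  have h3 := Real.sinh_lt_cosh (x - y)
  have h4 := Real.cosh_pos (x + y)
  linarith

lemma aux_suff (r : ℕ) (hr : 1 ≤ r) (a ν : ℝ) (ha : 0 < a) (h : ((r : ℝ) - 1) * a / 2 < ν) :
    MeasureTheory.IntegrableOn
      (fun t : Fin r → ℝ =>
        (∏ j : Fin r, Real.cosh (t j) ^ (-(2 * ν))) *
        ∏ p ∈ Finset.univ.filter (fun p : Fin r × Fin r => p.1 < p.2),
          Real.sinh (t p.1 - t p.2) ^ a)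
      {t : Fin r → ℝ | ∀ i j : Fin r, i < j → t j < t i}
      MeasureTheory.volume := by
  set c : ℝ := 2 * ν - (r - 1) * a with hc
  have hc0 : 0 < c := by rw [hc]; linarith
  set P := Finset.univ.filter (fun p : Fin r × Fin r => p.1 < p.2) with hP
  have hint : Integrable (fun t : Fin r → ℝ => ∏ j, Real.cosh (t j) ^ (-c)) :=
    Integrable.fintype_prod (f := fun _ x => Real.cosh x ^ (-c)) fun _ => aux_int_cosh c hc0
  refine Integrable.mono' ((hint.const_mul (((2:ℝ) ^ a) ^ P.card)).integrableOn)
    (aux_meas r a ν).aestronglyMeasurable ?_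
  refine (ae_restrict_iff' (aux_measSet r)).mpr (Filter.Eventually.of_forall fun t ht => ?_)
  have hpos : ∀ p ∈ P, 0 < Real.sinh (t p.1 - t p.2) := by
    intro p hp
    rw [Real.sinh_pos_iff]
    have := ht p.1 p.2 (by simpa [hP] using hp)
    linarith
  have hA : 0 ≤ ∏ j : Fin r, Real.cosh (t j) ^ (-(2 * ν)) :=
    Finset.prod_nonneg fun j _ => Real.rpow_nonneg (Real.cosh_pos _).le _
  have hB : 0 ≤ ∏ p ∈ P, Real.sinh (t p.1 - t p.2) ^ a :=
    Finset.prod_nonneg fun p hp => Real.rpow_nonneg (hpos p hp).le _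
  rw [Real.norm_of_nonneg (mul_nonneg hA hB)]
  have hB' : ∏ p ∈ P, Real.sinh (t p.1 - t p.2) ^ a
      ≤ ((2:ℝ) ^ a) ^ P.card * ∏ i, (Real.cosh (t i) ^ a) ^ (r - 1) := by
    rw [← aux_prod_pairs r (fun i => Real.cosh (t i) ^ a), ← Finset.prod_const,
      ← Finset.prod_mul_distrib]
    refine Finset.prod_le_prod (fun p hp => Real.rpow_nonneg (hpos p hp).le _) fun p hp => ?_
    have h1 := Real.cosh_pos (t p.1)
    have h2 := Real.cosh_pos (t p.2)
    rw [← Real.mul_rpow h1.le h2.le, ← Real.mul_rpow (by norm_num) (by positivity)]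
    exact Real.rpow_le_rpow (hpos p hp).le (aux_sinh_le _ _) ha.le
  refine (mul_le_mul_of_nonneg_left hB' hA).trans (le_of_eq ?_)
  rw [mul_left_comm, ← Finset.prod_mul_distrib]
  congr 1
  refine Finset.prod_congr rfl fun i _ => ?_
  have h1 := Real.cosh_pos (t i)
  rw [← Real.rpow_natCast, ← Real.rpow_mul h1.le, ← Real.rpow_add h1]
  congr 1
  rw [Nat.cast_sub hr, hc]
  push_cast
  ring

lemma aux_nec (n : ℕ) (a ν : ℝ) (ha : 0 < a) (h : ν ≤ (n : ℝ) * a / 2)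
    (hint : MeasureTheory.IntegrableOn
      (fun t : Fin (n+1) → ℝ =>
        (∏ j : Fin (n+1), Real.cosh (t j) ^ (-(2 * ν))) *
        ∏ p ∈ Finset.univ.filter (fun p : Fin (n+1) × Fin (n+1) => p.1 < p.2),
          Real.sinh (t p.1 - t p.2) ^ a)
      {t : Fin (n+1) → ℝ | ∀ i j : Fin (n+1), i < j → t j < t i}
      MeasureTheory.volume) : False := by
  set I : Fin (n+1) → Set ℝ :=
    Fin.cons (Set.Ioi 1) (fun j : Fin n => Set.Ioo (-(2 * (j:ℝ) + 1)) (-(2 * (j:ℝ)))) with hI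
  set S : Set (Fin (n+1) → ℝ) := Set.univ.pi I with hS
  have hSm : MeasurableSet S := by
    refine MeasurableSet.univ_pi fun i => ?_
    refine Fin.cases ?_ (fun j => ?_) i
    · simp [hI]
    · simp [hI]
  have hvol : volume S = ⊤ := by
    rw [hS, volume_pi_pi, Fin.prod_univ_succ]
    have : ∀ j : Fin n, volume (I j.succ) = 1 := by
      intro j
      simp only [hI, Fin.cons_succ, Real.volume_Ioo]
      rw [ENNReal.ofReal_eq_one]; ring
    rw [Finset.prod_congr rfl fun j _ => this j]
    simp [hI]
  have hmem : ∀ t ∈ S, 1 < t 0 ∧ ∀ j : Fin n, -(2 * (j:ℝ) + 1) < t j.succ ∧ t j.succ < -(2 * (j:ℝ)) := by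
    intro t ht
    refine ⟨?_, fun j => ?_⟩
    · simpa [hI] using ht 0 (Set.mem_univ _)
    · simpa only [hI, Fin.cons_succ, Set.mem_Ioo] using ht j.succ (Set.mem_univ _)
  have hgap : ∀ t ∈ S, ∀ i j : Fin n, i < j → 1 ≤ t i.succ - t j.succ := by
    intro t ht i j hij
    have h1 := ((hmem t ht).2 i).1
    have h2 := ((hmem t ht).2 j).2
    have h3 : (i:ℝ) + 1 ≤ (j:ℝ) := by exact_mod_cast hij
    linarith
  have hgap0 : ∀ t ∈ S, ∀ j : Fin n, t 0 ≤ t 0 - t j.succ := by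
    intro t ht j
    have h2 := ((hmem t ht).2 j).2
    have h3 : (0:ℝ) ≤ (j:ℝ) := Nat.cast_nonneg _
    linarith
  have hsub : S ⊆ {t : Fin (n+1) → ℝ | ∀ i j : Fin (n+1), i < j → t j < t i} := by
    intro t ht i j
    refine Fin.cases ?_ (fun j => ?_) j
    · intro hij; exact absurd hij (Fin.not_lt_zero _)
    · refine Fin.cases ?_ (fun i => ?_) i
      · intro _
        have := hgap0 t ht j
        have := (hmem t ht).1
        linarith
      · intro hij
        have := hgap t ht i j (by simpa using hij)
        linarith
  set K : ℝ := Real.cosh (2 * n + 1) ^ (-(2 * |ν|)) with hK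
  have hK0 : 0 < K := Real.rpow_pos_of_pos (Real.cosh_pos _) _
  set c : ℝ := K ^ n * (((2:ℝ) ^ a) ^ n)⁻¹ with hc
  have hc0 : 0 < c := by positivity
  have hlow : ∀ t ∈ S, c ≤ (∏ j : Fin (n+1), Real.cosh (t j) ^ (-(2 * ν))) *
        ∏ p ∈ Finset.univ.filter (fun p : Fin (n+1) × Fin (n+1) => p.1 < p.2),
          Real.sinh (t p.1 - t p.2) ^ a := by
    intro t ht
    obtain ⟨h0, hj⟩ := hmem t ht
    have hC := Real.cosh_pos (t 0)
    have hC1 := Real.one_le_cosh (t 0)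
    have hA : Real.cosh (t 0) ^ (-(2 * ν)) * K ^ n
        ≤ ∏ j : Fin (n+1), Real.cosh (t j) ^ (-(2 * ν)) := by
      rw [Fin.prod_univ_succ]
      refine mul_le_mul_of_nonneg_left ?_ (Real.rpow_nonneg hC.le _)
      have : K ^ n = ∏ _j : Fin n, K := by simp
      rw [this]
      refine Finset.prod_le_prod (fun _ _ => hK0.le) fun j _ => ?_
      obtain ⟨h1, h2⟩ := hj j
      have hjn : (j:ℝ) + 1 ≤ n := by exact_mod_cast j.2
      have hj0 : (0:ℝ) ≤ (j:ℝ) := Nat.cast_nonneg _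
      have h3 : Real.cosh (t j.succ) ≤ Real.cosh (2 * n + 1) := by
        rw [Real.cosh_le_cosh, abs_of_neg (by linarith), abs_of_nonneg (by positivity)]
        linarith
      calc K ≤ Real.cosh (t j.succ) ^ (-(2 * |ν|)) :=
            Real.rpow_le_rpow_of_nonpos (Real.cosh_pos _) h3 (by have := abs_nonneg ν; linarith)
        _ ≤ _ := Real.rpow_le_rpow_of_exponent_le (Real.one_le_cosh _)
            (by have := le_abs_self ν; linarith)
    have hB : ((Real.cosh (t 0) / 2) ^ a) ^ n
        ≤ ∏ p ∈ Finset.univ.filter (fun p : Fin (n+1) × Fin (n+1) => p.1 < p.2),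
          Real.sinh (t p.1 - t p.2) ^ a := by
      rw [Finset.prod_filter, Fintype.prod_prod_type, Fin.prod_univ_succ, ← mul_one (_ ^ n)]
      have hs : Real.cosh (t 0) / 2 ≤ Real.sinh (t 0) := by
        rw [Real.cosh_eq, Real.sinh_eq]
        have e1 : (2:ℝ) ≤ Real.exp (t 0) := by
          have := Real.add_one_le_exp (t 0); linarith
        have e2 : Real.exp (t 0) * Real.exp (-t 0) = 1 := by
          rw [← Real.exp_add]; simp
        have e3 := Real.exp_pos (-t 0)
        nlinarith
      have hX : ((Real.cosh (t 0) / 2) ^ a) ^ n ≤ ∏ j : Fin (n+1),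
          (if (0 : Fin (n+1)) < j then Real.sinh (t 0 - t j) ^ a else 1) := by
        rw [Fin.prod_univ_succ]
        simp only [lt_self_iff_false, if_false, Fin.succ_pos, if_true, one_mul]
        have : ((Real.cosh (t 0) / 2) ^ a) ^ n = ∏ _j : Fin n, (Real.cosh (t 0) / 2) ^ a := by simp
        rw [this]
        refine Finset.prod_le_prod (fun _ _ => by positivity) fun j _ => ?_
        refine Real.rpow_le_rpow (by positivity) (hs.trans ?_) ha.le
        exact Real.sinh_le_sinh.mpr (hgap0 t ht j)
      refine mul_le_mul hX ?_ zero_le_one (le_trans (by positivity) hX)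
      refine Finset.one_le_prod fun i _ => Finset.one_le_prod fun j _ => ?_
      dsimp only
      split_ifs with hij
      · revert hij
        refine Fin.cases ?_ (fun j => ?_) j
        · intro hij; exact absurd hij (Fin.not_lt_zero _)
        · intro hij
          have h1 := hgap t ht i j (by simpa using hij)
          exact Real.one_le_rpow (h1.trans (Real.self_le_sinh_iff.mpr (by linarith))) ha.le
      · exact le_rfl
    have hfin : c ≤ (Real.cosh (t 0) ^ (-(2 * ν)) * K ^ n) * ((Real.cosh (t 0) / 2) ^ a) ^ n := by
      have e : (Real.cosh (t 0) ^ (-(2 * ν)) * K ^ n) * ((Real.cosh (t 0) / 2) ^ a) ^ n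
          = c * Real.cosh (t 0) ^ (n * a - 2 * ν) := by
        rw [Real.div_rpow hC.le (by norm_num), div_pow, ← Real.rpow_natCast (Real.cosh (t 0) ^ a),
          ← Real.rpow_mul hC.le, sub_eq_add_neg, Real.rpow_add hC, hc, mul_comm a]
        ring
      rw [e]
      exact le_mul_of_one_le_right hc0.le (Real.one_le_rpow hC1 (by linarith))
    exact hfin.trans (mul_le_mul hA hB (by positivity) (le_trans (by positivity) hA))
  have hi2 : IntegrableOn (fun _ : Fin (n+1) → ℝ => c) S := by
    refine Integrable.mono (hint.mono_set hsub) aestronglyMeasurable_const ?_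
    refine (ae_restrict_iff' hSm).mpr (Filter.Eventually.of_forall fun t ht => ?_)
    rw [Real.norm_of_nonneg hc0.le]
    exact (hlow t ht).trans (le_abs_self _)
  rw [integrableOn_const_iff] at hi2
  · rcases hi2 with h | h
    · exact hc0.ne' (by simpa using h)
    · rw [hvol] at h; exact lt_irrefl _ h

/-- The polar-coordinate integrand for `∫_{D_ℝ} h(x)^ν dη(x)` is integrable
over the region `t₁ > t₂ > … > t_r` if and only if `ν > (r-1)a/2`. -/
theorem integrable_cosh_sinh_region_iff
    (r : ℕ) (hr : 1 ≤ r) (a ν : ℝ) (ha : 0 < a) :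
    MeasureTheory.IntegrableOn
      (fun t : Fin r → ℝ =>
        (∏ j : Fin r, Real.cosh (t j) ^ (-(2 * ν))) *
        ∏ p ∈ Finset.univ.filter (fun p : Fin r × Fin r => p.1 < p.2),
          Real.sinh (t p.1 - t p.2) ^ a)
      {t : Fin r → ℝ | ∀ i j : Fin r, i < j → t j < t i}
      MeasureTheory.volume
    ↔ ((r : ℝ) - 1) * a / 2 < ν := by
  refine ⟨fun h => ?_, aux_suff r hr a ν ha⟩
  by_contra hlt
  obtain ⟨n, rfl⟩ : ∃ n, r = n + 1 := ⟨r - 1, by omega⟩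
  refine aux_nec n a ν ha ?_ h
  push_cast at hlt
  have := not_lt.mp hlt
  simpa using this
end

section
/- Let ν > 0 be real. For every y ∈ (−1,1): ∫_{−1}^{1} (1−x²)^{ν/2−1} (1−y²)^{ν/2} (1−xy)^{−ν} dx = ∫_{−1}^{1} (1−x²)^{ν/2−1} dx. In other words, the function y ↦ ∫_{−1}^{1} (1−x²)^{ν/2−1} (1−y²)^{ν/2} (1−xy)^{−ν} dx is constant on (−1,1). -/
open MeasureTheory

/-- `∫_{-1}^1 (1-x²)^{ν/2-1}(1-y²)^{ν/2}(1-xy)^{-ν} dx` does not depend on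
`y ∈ (-1,1)`: it equals `∫_{-1}^1 (1-x²)^{ν/2-1} dx`. -/
theorem berezin_kernel_integral_const (ν : ℝ) (hν : 0 < ν)
    (y : ℝ) (hy : y ∈ Set.Ioo (-1 : ℝ) 1) :
    (∫ x in Set.Ioo (-1 : ℝ) 1,
        (1 - x ^ 2) ^ (ν / 2 - 1) * (1 - y ^ 2) ^ (ν / 2) * (1 - x * y) ^ (-ν))
      = ∫ x in Set.Ioo (-1 : ℝ) 1, (1 - x ^ 2) ^ (ν / 2 - 1) := by
  obtain ⟨hy1, hy2⟩ := hy
  have hY : 0 < 1 - y ^ 2 := by nlinarith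
  have hD : ∀ x ∈ Set.Ioo (-1 : ℝ) 1, 0 < 1 - x * y := by
    rintro x ⟨h1, h2⟩
    nlinarith [mul_pos (sub_pos.2 h1) (sub_pos.2 hy2), mul_pos (sub_pos.2 h2) (sub_pos.2 hy1)]
  have hmaps : ∀ x ∈ Set.Ioo (-1 : ℝ) 1, (y - x) / (1 - x * y) ∈ Set.Ioo (-1 : ℝ) 1 := by
    intro x hx
    have h := hD x hx
    obtain ⟨h1, h2⟩ := hx
    constructor
    · rw [lt_div_iff₀ h]
      nlinarith [mul_pos (sub_pos.2 h2) (sub_pos.2 hy1)]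
    · rw [div_lt_one h]
      nlinarith [mul_pos (sub_pos.2 h1) (sub_pos.2 hy2)]
  have hinv : ∀ x ∈ Set.Ioo (-1 : ℝ) 1,
      (y - (y - x) / (1 - x * y)) / (1 - (y - x) / (1 - x * y) * y) = x := by
    intro x hx
    have h := hD x hx
    have h' := hD _ (hmaps x hx)
    rw [div_eq_iff h'.ne']
    have hne : 1 - y * x ≠ 0 := by
      rw [mul_comm]
      exact h.ne'
    field_simp
    ring
  have himg : (fun x => (y - x) / (1 - x * y)) '' Set.Ioo (-1 : ℝ) 1 = Set.Ioo (-1 : ℝ) 1 := by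
    ext t
    constructor
    · rintro ⟨x, hx, rfl⟩
      exact hmaps x hx
    · intro ht
      exact ⟨_, hmaps t ht, hinv t ht⟩
  have hinj : Set.InjOn (fun x => (y - x) / (1 - x * y)) (Set.Ioo (-1 : ℝ) 1) := by
    intro a ha b hb hab
    simp only at hab
    rw [← hinv a ha, ← hinv b hb, hab]
  have key := integral_image_eq_integral_abs_deriv_smul
    (f' := fun x => (y ^ 2 - 1) / (1 - x * y) ^ 2) measurableSet_Ioo
    (fun x hx => by
      have h := hD x hx
      have h1 : HasDerivAt (fun x : ℝ => y - x) (-1) x := (hasDerivAt_id x).const_sub y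
      have h2 : HasDerivAt (fun x : ℝ => 1 - x * y) (-(1 * y)) x :=
        ((hasDerivAt_id x).mul_const y).const_sub 1
      have h3 := (h1.div h2 h.ne').hasDerivWithinAt (s := Set.Ioo (-1 : ℝ) 1)
      have h4 : (y ^ 2 - 1) / (1 - x * y) ^ 2
          = (-1 * (1 - x * y) - (y - x) * (-(1 * y))) / (1 - x * y) ^ 2 := by ring
      exact h4 ▸ h3) hinj (fun x => (1 - x ^ 2) ^ (ν / 2 - 1))
  rw [himg] at key
  rw [key]
  refine setIntegral_congr_fun measurableSet_Ioo fun x hx => ?_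
  have h := hD x hx
  have hX : 0 < 1 - x ^ 2 := by nlinarith [hx.1, hx.2]
  have e1 : 1 - ((y - x) / (1 - x * y)) ^ 2
      = (1 - x ^ 2) * (1 - y ^ 2) / (1 - x * y) ^ 2 := by
    have hne : 1 - y * x ≠ 0 := by
      rw [mul_comm]
      exact h.ne'
    field_simp
    ring
  have e2 : |(y ^ 2 - 1) / (1 - x * y) ^ 2| = (1 - y ^ 2) / (1 - x * y) ^ 2 := by
    rw [abs_div, abs_of_neg (by linarith), abs_of_pos (by positivity)]
    ring
  have e3 : ((1 - x * y) ^ 2) ^ (ν / 2 - 1) = (1 - x * y) ^ (ν - 2) := by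
    rw [← Real.rpow_natCast, ← Real.rpow_mul h.le]
    congr 1
    push_cast
    ring
  simp only [smul_eq_mul]
  rw [e1, e2, Real.div_rpow (by positivity) (by positivity), Real.mul_rpow hX.le hY.le, e3,
    Real.rpow_sub_one hY.ne', Real.rpow_neg h.le, Real.rpow_sub h, Real.rpow_two]
  have hp : 0 < (1 - x * y) ^ ν := Real.rpow_pos_of_pos h _
  field_simp
end

section
/- Let ν > 0 be real and λ ∈ ℂ. For all x ∈ (−1,1): 2x G_{ν,λ}′(x) + ν G_{ν,λ}(x) = (ν/2 + iλ) G_{ν,λ−i}(x) + (ν/2 − iλ) G_{ν,λ+i}(x). -/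
open Complex

/-- The generating function `G_{ν,λ}(x) = (1-x)^{-ν/2-iλ}(1+x)^{-ν/2+iλ}` on `(-1,1)`
(principal branch complex powers). -/
noncomputable def genFun (ν : ℝ) (l : ℂ) (x : ℝ) : ℂ :=
  (1 - (x : ℂ)) ^ (-(ν : ℂ) / 2 - Complex.I * l) *
    (1 + (x : ℂ)) ^ (-(ν : ℂ) / 2 + Complex.I * l)

/-- `2x G_{ν,λ}'(x) + ν G_{ν,λ}(x)
  = (ν/2 + iλ) G_{ν,λ-i}(x) + (ν/2 - iλ) G_{ν,λ+i}(x)` on `(-1,1)`. -/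
theorem genFun_difference_relation (ν : ℝ) (hν : 0 < ν) (l : ℂ) :
    ∀ x ∈ Set.Ioo (-1 : ℝ) 1,
      DifferentiableAt ℝ (genFun ν l) x ∧
      2 * (x : ℂ) * deriv (genFun ν l) x + (ν : ℂ) * genFun ν l x
        = ((ν : ℂ) / 2 + Complex.I * l) * genFun ν (l - Complex.I) x
          + ((ν : ℂ) / 2 - Complex.I * l) * genFun ν (l + Complex.I) x := by
  intro x hx
  have h1 : (1 - (x : ℂ)) ≠ 0 := by
    have : (1 - x) ≠ 0 := (by linarith [hx.2] : 0 < 1 - x).ne'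
    exact_mod_cast this
  have h2 : (1 + (x : ℂ)) ≠ 0 := by
    have : (1 + x) ≠ 0 := (by linarith [hx.1] : 0 < 1 + x).ne'
    exact_mod_cast this
  have s1 : (1 - (x : ℂ)) ∈ slitPlane := by
    left
    simpa using hx.2
  have s2 : (1 + (x : ℂ)) ∈ slitPlane := by
    left
    simpa using (by linarith [hx.1] : 0 < 1 + x)
  have dx : HasDerivAt (fun y : ℝ => (y : ℂ)) 1 x := Complex.ofRealCLM.hasDerivAt
  have key : ∀ (a b : ℂ), HasDerivAt
      (fun y : ℝ => (1 - (y : ℂ)) ^ a * (1 + (y : ℂ)) ^ b)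
      ((1 - (x : ℂ)) ^ a * (1 + (x : ℂ)) ^ b * (-a / (1 - x) + b / (1 + x))) x := by
    intro a b
    have e1 : HasDerivAt (fun z : ℂ => (1 - z) ^ a) _ (x : ℂ) :=
      ((hasDerivAt_id (x : ℂ)).const_sub 1).cpow_const s1
    have e2 : HasDerivAt (fun z : ℂ => (1 + z) ^ b) _ (x : ℂ) :=
      ((hasDerivAt_id (x : ℂ)).const_add 1).cpow_const s2
    have e := (e1.mul e2).comp_ofReal
    refine e.congr_deriv ?_
    simp only [id]
    rw [Complex.cpow_sub _ _ h1, Complex.cpow_sub _ _ h2, Complex.cpow_one, Complex.cpow_one]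
    field_simp
  have hd : HasDerivAt (genFun ν l) _ x := key (-(ν : ℂ) / 2 - I * l) (-(ν : ℂ) / 2 + I * l)
  refine ⟨hd.differentiableAt, ?_⟩
  rw [hd.deriv]
  unfold genFun
  have a1 : -(ν : ℂ) / 2 - I * (l - I) = (-(ν : ℂ) / 2 - I * l) - 1 := by
    linear_combination I_mul_I
  have a2 : -(ν : ℂ) / 2 + I * (l - I) = (-(ν : ℂ) / 2 + I * l) + 1 := by
    linear_combination -I_mul_I
  have a3 : -(ν : ℂ) / 2 - I * (l + I) = (-(ν : ℂ) / 2 - I * l) + 1 := by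
    linear_combination -I_mul_I
  have a4 : -(ν : ℂ) / 2 + I * (l + I) = (-(ν : ℂ) / 2 + I * l) - 1 := by
    linear_combination I_mul_I
  rw [a1, a2, a3, a4, Complex.cpow_sub (_ - _) 1 h1, Complex.cpow_sub (_ + _) 1 h2,
    Complex.cpow_add (_ - _) 1 h1, Complex.cpow_add (_ + _) 1 h2, Complex.cpow_one, Complex.cpow_one]
  generalize (1 - (x : ℂ)) ^ (-(ν : ℂ) / 2 - I * l) = A
  generalize (1 + (x : ℂ)) ^ (-(ν : ℂ) / 2 + I * l) = B
  field_simp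
  ring
end

section
/- Let ν > 1 be real and let f : (0,∞) → ℂ be measurable with ∫₀^∞ |f(x)|² x^{ν−1} dx < ∞. For u > 0 and v ∈ ℝ define F(u + iv) = ∫₀^∞ e^{−(u+iv)x} f(x) x^{ν−1} dx (the integral converges absolutely). Then (2^ν / (4π Γ(ν−1))) · ∫₀^∞ ∫_ℝ |F(u + iv)|² u^{ν−2} dv du = ∫₀^∞ |f(x)|² x^{ν−1} dx. -/
open Complex MeasureTheory Real

open FourierTransform SchwartzMap in
lemma aux_fourier_ae (g : ℝ → ℂ) (h1 : Integrable g) (h2 : MemLp g 2) :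
    ∀ᵐ x, (𝓕 g) x = (𝓕 (h2.toLp g) : Lp ℂ 2 (volume : Measure ℝ)) x := by
  have hcont : Continuous (𝓕 g) :=
    VectorFourier.fourierIntegral_continuous Real.continuous_fourierChar
      (by exact continuous_inner) h1
  apply ae_eq_of_integral_contDiff_smul_eq hcont.locallyIntegrable
  · exact (Lp.memLp _).locallyIntegrable (by norm_num)
  intro φ hφ hφc
  have hφc' : HasCompactSupport (fun x => (φ x : ℂ)) := hφc.comp_left (g := Complex.ofReal) rfl
  let ψ : 𝓢(ℝ, ℂ) := hφc'.toSchwartzMap (Complex.ofRealCLM.contDiff.comp hφ)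
  have hψ : ∀ x, ψ x = (φ x : ℂ) := fun x => rfl
  have key := congrArg (fun T => T ψ) (Lp.fourier_toTemperedDistribution_eq (h2.toLp g))
  simp only [TemperedDistribution.fourier_apply, Lp.toTemperedDistribution_apply] at key
  have e1 : ∫ x, φ x • (𝓕 (h2.toLp g) : Lp ℂ 2 (volume : Measure ℝ)) x
      = ∫ x, ψ x • (𝓕 (h2.toLp g) : Lp ℂ 2 (volume : Measure ℝ)) x := by
    simp [hψ]
  have e2 : ∫ x, φ x • (𝓕 g) x = ∫ x, ψ x • (𝓕 g) x := by
    simp [hψ]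
  rw [e1, e2, ← key]
  have e3 : ∫ x, (𝓕 ψ) x • (h2.toLp g) x = ∫ x, (𝓕 ψ) x • g x := by
    apply integral_congr_ae
    filter_upwards [h2.coeFn_toLp] with x hx
    rw [hx]
  rw [e3, SchwartzMap.fourier_coe]
  symm
  simpa using! (VectorFourier.integral_fourierIntegral_smul_eq_flip (L := innerₗ ℝ)
    Real.continuous_fourierChar continuous_inner ψ.integrable h1)

lemma aux_L2 (h : Lp ℂ 2 (volume : Measure ℝ)) : ∫ x, ‖h x‖ ^ 2 = ‖h‖ ^ 2 := by
  have := L2.inner_def (𝕜 := ℂ) h h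
  rw [inner_self_eq_norm_sq_to_K] at this
  simp only [inner_self_eq_norm_sq_to_K] at this
  have h2 : ((‖h‖ ^ 2 : ℝ) : ℂ) = ((∫ x, ‖h x‖ ^ 2 : ℝ) : ℂ) := by
    rw [← integral_complex_ofReal]
    simpa using this
  exact_mod_cast h2.symm

open FourierTransform in
lemma aux_plancherel (g : ℝ → ℂ) (h1 : Integrable g) (h2 : MemLp g 2) :
    ∫ x, ‖(𝓕 g) x‖ ^ 2 = ∫ x, ‖g x‖ ^ 2 := by
  have a : ∫ x, ‖(𝓕 g) x‖ ^ 2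
      = ∫ x, ‖(𝓕 (h2.toLp g) : Lp ℂ 2 (volume : Measure ℝ)) x‖ ^ 2 := by
    apply integral_congr_ae
    filter_upwards [aux_fourier_ae g h1 h2] with x hx
    rw [hx]
  have b : ∫ x, ‖g x‖ ^ 2 = ∫ x, ‖(h2.toLp g) x‖ ^ 2 := by
    apply integral_congr_ae
    filter_upwards [h2.coeFn_toLp] with x hx
    rw [hx]
  rw [a, b, aux_L2, aux_L2, Lp.norm_fourier_eq]

open FourierTransform in
lemma aux_plancherel' (g : ℝ → ℂ) (h1 : Integrable g) (h2 : MemLp g 2) :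
    ∫ v : ℝ, ‖∫ x : ℝ, Complex.exp (-((v : ℂ) * Complex.I) * (x : ℂ)) * g x‖ ^ 2
      = 2 * Real.pi * ∫ x, ‖g x‖ ^ 2 := by
  rw [← aux_plancherel g h1 h2]
  have := Measure.integral_comp_div (fun w : ℝ => ‖(𝓕 g) w‖ ^ 2) (2 * Real.pi)
  rw [abs_of_pos (by positivity), smul_eq_mul] at this
  rw [← this]
  congr 1
  ext v
  congr 2
  rw [Real.fourier_eq']
  congr 1
  ext x
  rw [smul_eq_mul]
  congr 2
  have hp : (Real.pi : ℂ) ≠ 0 := by exact_mod_cast Real.pi_ne_zero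
  simp
  field_simp

lemma aux_bound (s u : ℝ) (hs : 0 < s) (hu : 0 < u) (x : ℝ) (hx : 0 < x) :
    Real.exp (-(2 * u) * x) * x ^ s ≤ (s / (2 * u)) ^ s := by
  have h : 2 * u * x / s ≤ Real.exp (2 * u * x / s) := by
    linarith [Real.add_one_le_exp (2 * u * x / s)]
  have h' := Real.rpow_le_rpow (by positivity) h hs.le
  rw [← Real.exp_mul, div_mul_cancel₀ _ hs.ne'] at h'
  have e : x ^ s = (2 * u * x / s) ^ s * (s / (2 * u)) ^ s := by
    rw [← Real.mul_rpow (by positivity) (by positivity)]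
    congr 1
    field_simp
  have e2 : Real.exp (-(2 * u) * x) * Real.exp (2 * u * x) = 1 := by
    rw [← Real.exp_add]; simp
  calc Real.exp (-(2 * u) * x) * x ^ s
      = Real.exp (-(2 * u) * x) * (2 * u * x / s) ^ s * (s / (2 * u)) ^ s := by rw [e]; ring
    _ ≤ Real.exp (-(2 * u) * x) * Real.exp (2 * u * x) * (s / (2 * u)) ^ s := by gcongr
    _ = _ := by rw [e2, one_mul]

lemma aux_normsq (ν u : ℝ) (f : ℝ → ℂ) (x : ℝ) :
    ‖Complex.exp (-((u : ℂ) * x)) * f x * ((x ^ (ν - 1) : ℝ) : ℂ)‖ ^ 2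
      = (Real.exp (-(2 * u) * x) * x ^ (ν - 1)) * (‖f x‖ ^ 2 * x ^ (ν - 1)) := by
  rw [norm_mul, norm_mul, Complex.norm_exp, Complex.norm_real, mul_pow, mul_pow,
    ← Real.exp_nat_mul, Real.norm_eq_abs, sq_abs]
  have : (2 : ℕ) * (-((u : ℂ) * x)).re = -(2 * u) * x := by
    simp; ring
  rw [this]; ring

lemma aux_gamma (s x : ℝ) (hs : 0 < s) (hx : 0 < x) :
    IntegrableOn (fun u : ℝ => u ^ (s - 1) * Real.exp (-(x * u))) (Set.Ioi 0) := by
  have := integrableOn_rpow_mul_exp_neg_mul_rpow (p := 1) (s := s - 1) (b := x)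
    (by linarith) one_pos hx
  simpa using this

lemma aux_sq (ν : ℝ) (hν : 1 < ν) (f : ℝ → ℂ) (hmeas : Measurable f)
    (hf : IntegrableOn (fun x : ℝ => ‖f x‖ ^ 2 * x ^ (ν - 1)) (Set.Ioi 0)) (u : ℝ) (hu : 0 < u) :
    IntegrableOn (fun x : ℝ => (Real.exp (-(2 * u) * x) * x ^ (ν - 1)) *
      (‖f x‖ ^ 2 * x ^ (ν - 1))) (Set.Ioi 0) := by
  refine Integrable.bdd_mul (c := ((ν - 1) / (2 * u)) ^ (ν - 1)) hf
    (Measurable.aestronglyMeasurable (by fun_prop)) ?_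
  rw [ae_restrict_iff' measurableSet_Ioi]
  refine ae_of_all _ fun x hx => ?_
  have hx : 0 < x := hx
  rw [Real.norm_of_nonneg (by positivity)]
  exact aux_bound _ _ (by linarith) hu x hx

lemma aux_int (ν : ℝ) (hν : 1 < ν) (f : ℝ → ℂ) (hmeas : Measurable f)
    (hf : IntegrableOn (fun x : ℝ => ‖f x‖ ^ 2 * x ^ (ν - 1)) (Set.Ioi 0)) (u : ℝ) (hu : 0 < u)
    (v : ℝ) :
    IntegrableOn
        (fun x : ℝ => Complex.exp (-((u : ℂ) + (v : ℂ) * Complex.I) * (x : ℂ)) * f x *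
          ((x ^ (ν - 1) : ℝ) : ℂ)) (Set.Ioi 0) := by
  have h := (aux_gamma ν (2 * u) (by linarith) (by linarith)).add hf
  refine Integrable.mono' h (Measurable.aestronglyMeasurable (by fun_prop)) ?_
  rw [ae_restrict_iff' measurableSet_Ioi]
  refine ae_of_all _ fun x hx => ?_
  have hx : 0 < x := hx
  rw [norm_mul, norm_mul, Complex.norm_exp, Complex.norm_real, Real.norm_of_nonneg (by positivity)]
  have e1 : (-((u : ℂ) + (v : ℂ) * Complex.I) * (x : ℂ)).re = -(u * x) := by simp
  have e2 : Real.exp (-(2 * u * x)) = Real.exp (-(u * x)) ^ 2 := by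
    rw [← Real.exp_nat_mul]; congr 1; push_cast; ring
  rw [e1]
  simp only [Pi.add_apply]
  rw [e2]
  have hp : 0 < x ^ (ν - 1) := by positivity
  have : Real.exp (-(u * x)) * ‖f x‖ ≤ Real.exp (-(u * x)) ^ 2 + ‖f x‖ ^ 2 := by
    nlinarith [sq_nonneg (Real.exp (-(u * x)) - ‖f x‖), sq_nonneg (Real.exp (-(u * x))),
      sq_nonneg ‖f x‖]
  nlinarith [mul_le_mul_of_nonneg_right this hp.le]

lemma aux_inner (ν : ℝ) (hν : 1 < ν) (f : ℝ → ℂ) (hmeas : Measurable f)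
    (hf : IntegrableOn (fun x : ℝ => ‖f x‖ ^ 2 * x ^ (ν - 1)) (Set.Ioi 0)) (u : ℝ) (hu : 0 < u) :
    (∫ v : ℝ, ‖∫ x in Set.Ioi (0 : ℝ),
      Complex.exp (-((u : ℂ) + (v : ℂ) * Complex.I) * (x : ℂ)) * f x *
                ((x ^ (ν - 1) : ℝ) : ℂ)‖ ^ 2)
    = 2 * Real.pi * ∫ x in Set.Ioi (0 : ℝ), (Real.exp (-(2 * u) * x) * x ^ (ν - 1)) *
      (‖f x‖ ^ 2 * x ^ (ν - 1)) := by
  let g0 : ℝ → ℂ := fun x => Complex.exp (-((u : ℂ) * x)) * f x * ((x ^ (ν - 1) : ℝ) : ℂ)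
  let g : ℝ → ℂ := (Set.Ioi (0 : ℝ)).indicator g0
  have h0 : Measurable g0 := by fun_prop
  have hm : Measurable g := h0.indicator measurableSet_Ioi
  have hsq : (fun x => ‖g x‖ ^ 2) = (Set.Ioi (0 : ℝ)).indicator (fun x : ℝ =>
      (Real.exp (-(2 * u) * x) * x ^ (ν - 1)) * (‖f x‖ ^ 2 * x ^ (ν - 1))) := by
    ext x
    by_cases hx : x ∈ Set.Ioi (0 : ℝ)
    · simp only [g, Set.indicator_of_mem hx]
      exact aux_normsq ν u f x
    · simp [g, Set.indicator_of_notMem hx]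
  have h1 : Integrable g := by
    rw [integrable_indicator_iff measurableSet_Ioi]
    simpa [g0] using aux_int ν hν f hmeas hf u hu 0
  have h2 : MemLp g 2 := by
    rw [memLp_two_iff_integrable_sq_norm hm.aestronglyMeasurable, hsq,
      integrable_indicator_iff measurableSet_Ioi]
    exact aux_sq ν hν f hmeas hf u hu
  rw [← integral_indicator measurableSet_Ioi, ← hsq, ← aux_plancherel' g h1 h2]
  congr 1
  ext v
  congr 2
  rw [← integral_indicator measurableSet_Ioi]
  congr 1
  ext x
  by_cases hx : x ∈ Set.Ioi (0 : ℝ)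
  · simp only [g, g0, Set.indicator_of_mem hx]
    rw [← mul_assoc, ← mul_assoc, ← Complex.exp_add]
    congr 3
    ring
  · simp [g, Set.indicator_of_notMem hx]

lemma aux_gamma_int (ν : ℝ) (hν : 1 < ν) (c x : ℝ) (hx : 0 < x) :
    ∫ u in Set.Ioi (0 : ℝ), (Real.exp (-(2 * u) * x) * x ^ (ν - 1)) *
      (c * x ^ (ν - 1)) * u ^ (ν - 2)
    = (Real.Gamma (ν - 1) / 2 ^ (ν - 1)) * (c * x ^ (ν - 1)) := by
  have h := Real.integral_rpow_mul_exp_neg_mul_Ioi (a := ν - 1) (r := 2 * x)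
    (by linarith) (by linarith)
  have e : ∀ u : ℝ, (Real.exp (-(2 * u) * x) * x ^ (ν - 1)) *
      (c * x ^ (ν - 1)) * u ^ (ν - 2) =
      (x ^ (ν - 1) * (c * x ^ (ν - 1))) * (u ^ (ν - 1 - 1) * Real.exp (-(2 * x * u))) := by
    intro u
    rw [show -(2 * u) * x = -(2 * x * u) by ring, show ν - 1 - 1 = ν - 2 by ring]
    ring
  simp_rw [e]
  rw [integral_const_mul, h, Real.div_rpow zero_le_one (by positivity),
    Real.mul_rpow zero_le_two hx.le, Real.one_rpow]
  have : 0 < x ^ (ν - 1) := by positivity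
  field_simp

/-- the Laplace transform is an isometry from
`L²((0,∞), x^{ν-1}dx)` onto the weighted Bergman space on the right half-plane:
`(2^ν/(4π Γ(ν-1))) ∫₀^∞ ∫_ℝ |F(u+iv)|² u^{ν-2} dv du = ∫₀^∞ |f(x)|² x^{ν-1} dx`,
where `F(u+iv) = ∫₀^∞ e^{-(u+iv)x} f(x) x^{ν-1} dx` (absolutely convergent). -/
theorem laplace_transform_unitary_halfline (ν : ℝ) (hν : 1 < ν)
    (f : ℝ → ℂ) (hmeas : Measurable f)
    (hf : MeasureTheory.IntegrableOn (fun x : ℝ => ‖f x‖ ^ 2 * x ^ (ν - 1)) (Set.Ioi 0)) :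
    (∀ u : ℝ, 0 < u → ∀ v : ℝ,
      MeasureTheory.IntegrableOn
        (fun x : ℝ => Complex.exp (-((u : ℂ) + (v : ℂ) * Complex.I) * (x : ℂ)) * f x *
          ((x ^ (ν - 1) : ℝ) : ℂ)) (Set.Ioi 0)) ∧
    (2 ^ ν / (4 * Real.pi * Real.Gamma (ν - 1))) *
      (∫ u in Set.Ioi (0 : ℝ),
        (∫ v : ℝ,
          ‖∫ x in Set.Ioi (0 : ℝ),
              Complex.exp (-((u : ℂ) + (v : ℂ) * Complex.I) * (x : ℂ)) * f x *
                ((x ^ (ν - 1) : ℝ) : ℂ)‖ ^ 2) * u ^ (ν - 2))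
      = ∫ x in Set.Ioi (0 : ℝ), ‖f x‖ ^ 2 * x ^ (ν - 1) := by
  refine ⟨fun u hu v => aux_int ν hν f hmeas hf u hu v, ?_⟩
  have hG : 0 < Real.Gamma (ν - 1) := Real.Gamma_pos_of_pos (by linarith)
  let G : ℝ → ℝ → ℝ := fun u x => (Real.exp (-(2 * u) * x) * x ^ (ν - 1)) *
      (‖f x‖ ^ 2 * x ^ (ν - 1)) * u ^ (ν - 2)
  have hGm : Measurable (Function.uncurry G) := by
    simp only [G, Function.uncurry_def]
    fun_prop
  have hGi : Integrable (Function.uncurry G)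
      ((volume.restrict (Set.Ioi (0 : ℝ))).prod (volume.restrict (Set.Ioi (0 : ℝ)))) := by
    rw [integrable_prod_iff' hGm.aestronglyMeasurable]
    constructor
    · rw [ae_restrict_iff' measurableSet_Ioi]
      refine ae_of_all _ fun x hx => ?_
      have hx : 0 < x := hx
      have := (aux_gamma (ν - 1) (2 * x) (by linarith) (by linarith)).const_mul
        (x ^ (ν - 1) * (‖f x‖ ^ 2 * x ^ (ν - 1)))
      refine this.congr (ae_of_all _ fun u => ?_)
      simp only [Function.uncurry, G]
      rw [show -(2 * u) * x = -(2 * x * u) by ring, show ν - 1 - 1 = ν - 2 by ring]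
      ring
    · refine (hf.const_mul (Real.Gamma (ν - 1) / 2 ^ (ν - 1))).congr ?_
      rw [Filter.EventuallyEq, ae_restrict_iff' measurableSet_Ioi]
      refine ae_of_all _ fun x hx => ?_
      have hx : 0 < x := hx
      rw [← aux_gamma_int ν hν _ x hx]
      refine setIntegral_congr_fun measurableSet_Ioi fun u hu => ?_
      have hu : 0 < u := hu
      simp only [Function.uncurry, G]
      rw [Real.norm_of_nonneg (by positivity)]
  have e1 : (∫ u in Set.Ioi (0 : ℝ),
        (∫ v : ℝ,
          ‖∫ x in Set.Ioi (0 : ℝ),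
              Complex.exp (-((u : ℂ) + (v : ℂ) * Complex.I) * (x : ℂ)) * f x *
                ((x ^ (ν - 1) : ℝ) : ℂ)‖ ^ 2) * u ^ (ν - 2))
      = 2 * Real.pi * ∫ u in Set.Ioi (0 : ℝ), ∫ x in Set.Ioi (0 : ℝ), G u x := by
    rw [← integral_const_mul]
    refine setIntegral_congr_fun measurableSet_Ioi fun u hu => ?_
    have hu : 0 < u := hu
    rw [aux_inner ν hν f hmeas hf u hu, mul_assoc, ← integral_mul_const]
  have e2 : ∫ x in Set.Ioi (0 : ℝ), ∫ u in Set.Ioi (0 : ℝ), G u x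
      = (Real.Gamma (ν - 1) / 2 ^ (ν - 1)) *
        ∫ x in Set.Ioi (0 : ℝ), ‖f x‖ ^ 2 * x ^ (ν - 1) := by
    rw [← integral_const_mul]
    exact setIntegral_congr_fun measurableSet_Ioi fun x hx => aux_gamma_int ν hν _ x hx
  rw [e1, integral_integral_swap hGi, e2]
  have h2 : (2 : ℝ) ^ ν = 2 ^ (ν - 1) * 2 := by
    rw [Real.rpow_sub_one (by norm_num)]; ring
  rw [h2]
  have : (0 : ℝ) < 2 ^ (ν - 1) := by positivity
  field_simp
  norm_num
end

section
/- Let ν > 0 be real, and let ℓ_m^ν(x) = e^{−x} L_m^ν(2x) be the Laguerre functions. For every integer m ≥ 0 and every x ∈ ℝ (with the convention ℓ_{−1}^ν = 0): 2x (ℓ_m^ν)′(x) = −ν ℓ_m^ν(x) − m(m − 1 + ν) ℓ_{m−1}^ν(x) + ℓ_{m+1}^ν(x). -/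
open Real

/-- Pochhammer symbol `(ν)_k = ν(ν+1)⋯(ν+k-1)`. -/
noncomputable def poch (ν : ℝ) (k : ℕ) : ℝ := ∏ i ∈ Finset.range k, (ν + i)

/-- The Laguerre polynomial `L_m^ν(x) = Σ_{n=0}^m C(m,n) ((ν)_m/(ν)_n) (-x)^n`. -/
noncomputable def lagPoly (ν : ℝ) (m : ℕ) (x : ℝ) : ℝ :=
  ∑ n ∈ Finset.range (m + 1), (m.choose n : ℝ) * (poch ν m / poch ν n) * (-x) ^ n

/-- The Laguerre function `ℓ_m^ν(x) = e^{-x} L_m^ν(2x)`. -/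
noncomputable def lagFun (ν : ℝ) (m : ℕ) (x : ℝ) : ℝ :=
  Real.exp (-x) * lagPoly ν m (2 * x)


lemma poch_ne (ν : ℝ) (hν : 0 < ν) (k : ℕ) : poch ν k ≠ 0 := by
  unfold poch
  exact Finset.prod_ne_zero_iff.mpr (fun i _ => by positivity)

lemma poch_succ (ν : ℝ) (k : ℕ) : poch ν (k + 1) = poch ν k * (ν + k) := by
  unfold poch
  rw [Finset.prod_range_succ]

lemma choose_a (m n : ℕ) :
    ((n : ℝ) + 1) * (m.choose (n + 1) : ℝ) = ((m : ℝ) - n) * (m.choose n : ℝ) := by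
  rcases le_or_gt n m with h | h
  · have := Nat.choose_succ_right_eq m n
    have h2 : ((m.choose (n + 1) * (n + 1) : ℕ) : ℝ) = ((m.choose n * (m - n) : ℕ) : ℝ) := by
      rw [this]
    push_cast [Nat.cast_sub h] at h2
    linarith
  · rw [Nat.choose_eq_zero_of_lt h, Nat.choose_eq_zero_of_lt (by omega)]
    simp

lemma choose_b (m n : ℕ) :
    (m : ℝ) * ((m - 1).choose n : ℝ) = ((m : ℝ) - n) * (m.choose n : ℝ) := by
  rcases m with _ | k
  · rcases n with _ | n <;> simp
  · rcases n with _ | n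
    · simp
    · have h1 := choose_a k n
      have h2 : ((k + 1).choose (n + 1) : ℝ) = k.choose n + k.choose (n + 1) := by
        rw [Nat.choose_succ_succ]; push_cast; ring
      simp only [Nat.add_sub_cancel, h2]
      push_cast
      linarith

lemma lagPoly_ext (ν : ℝ) (m N : ℕ) (h : m + 1 ≤ N) (y : ℝ) :
    lagPoly ν m y =
      ∑ n ∈ Finset.range N, (m.choose n : ℝ) * (poch ν m / poch ν n) * (-y) ^ n := by
  unfold lagPoly
  apply Finset.sum_subset (Finset.range_mono h)
  intro n _ hn
  rw [Nat.choose_eq_zero_of_lt (by simpa using hn)]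
  simp

lemma lagPoly_deriv (ν : ℝ) (m : ℕ) (y : ℝ) :
    ∃ D, HasDerivAt (lagPoly ν m) D y ∧
      y * D = ∑ n ∈ Finset.range (m + 2),
        (n : ℝ) * ((m.choose n : ℝ) * (poch ν m / poch ν n)) * (-y) ^ n := by
  refine ⟨∑ n ∈ Finset.range (m + 2), (m.choose n : ℝ) * (poch ν m / poch ν n) *
    ((n : ℝ) * (-y) ^ (n - 1) * (-1)), ?_, ?_⟩
  · have : lagPoly ν m = fun y => ∑ n ∈ Finset.range (m + 2),
        (m.choose n : ℝ) * (poch ν m / poch ν n) * (-y) ^ n := by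
      funext y
      exact lagPoly_ext ν m _ (by omega) y
    rw [this]
    apply HasDerivAt.fun_sum
    intro n _
    exact ((hasDerivAt_neg y).fun_pow n).const_mul _
  · rw [Finset.mul_sum]
    apply Finset.sum_congr rfl
    intro n _
    rcases n with _ | n
    · simp
    · simp only [Nat.add_sub_cancel]
      ring

lemma poly_rec (ν : ℝ) (hν : 0 < ν) (m : ℕ) (y : ℝ) :
    -y * lagPoly ν m y + 2 * ∑ n ∈ Finset.range (m + 2),
        (n : ℝ) * ((m.choose n : ℝ) * (poch ν m / poch ν n)) * (-y) ^ n
      = -ν * lagPoly ν m y - (m : ℝ) * ((m : ℝ) - 1 + ν) * lagPoly ν (m - 1) y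
        + lagPoly ν (m + 1) y := by
  have hm : ∀ n : ℕ, (m : ℝ) * ((m : ℝ) - 1 + ν) * (((m - 1).choose n : ℝ) *
      (poch ν (m - 1) / poch ν n)) = ((m : ℝ) - n) * (m.choose n : ℝ) *
      (poch ν m / poch ν n) := by
    intro n
    rw [← choose_b]
    rcases m with _ | k
    · simp
    · simp only [Nat.add_sub_cancel, poch_succ]
      push_cast
      ring
  have h1 : -y * lagPoly ν m y = ∑ n ∈ Finset.range (m + 1),
      (m.choose n : ℝ) * (poch ν m / poch ν n) * (-y) ^ (n + 1) := by
    unfold lagPoly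
    rw [Finset.mul_sum]
    exact Finset.sum_congr rfl (fun n _ => by ring)
  have h3 : (m : ℝ) * ((m : ℝ) - 1 + ν) * lagPoly ν (m - 1) y =
      ∑ n ∈ Finset.range (m + 2), ((m : ℝ) - n) * (m.choose n : ℝ) *
      (poch ν m / poch ν n) * (-y) ^ n := by
    rw [lagPoly_ext ν (m - 1) (m + 2) (by omega), Finset.mul_sum]
    exact Finset.sum_congr rfl (fun n _ => by rw [← hm]; ring)
  rw [h1, h3, lagPoly_ext ν m (m + 2) (by omega), lagPoly_ext ν (m + 1) (m + 2) le_rfl]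
  simp only [Finset.sum_range_succ' _ (m + 1)]
  have key : ∑ n ∈ Finset.range (m + 1),
      ((m.choose n : ℝ) * (poch ν m / poch ν n) * (-y) ^ (n + 1)
      + 2 * (((n + 1 : ℕ) : ℝ) * ((m.choose (n + 1) : ℝ) * (poch ν m / poch ν (n + 1)))
        * (-y) ^ (n + 1))
      + ν * ((m.choose (n + 1) : ℝ) * (poch ν m / poch ν (n + 1)) * (-y) ^ (n + 1))
      + ((m : ℝ) - (n + 1 : ℕ)) * (m.choose (n + 1) : ℝ) *
        (poch ν m / poch ν (n + 1)) * (-y) ^ (n + 1)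
      - ((m + 1).choose (n + 1) : ℝ) * (poch ν (m + 1) / poch ν (n + 1)) * (-y) ^ (n + 1))
      = 0 := by
    apply Finset.sum_eq_zero
    intro n _
    have ha := choose_a m n
    have hp := poch_ne ν hν n
    have hq : ν + (n : ℝ) ≠ 0 := by positivity
    rw [Nat.choose_succ_succ, poch_succ, poch_succ]
    push_cast
    field_simp
    linear_combination (poch ν m * (-y) ^ (n + 1)) * ha
  simp only [Finset.sum_sub_distrib, Finset.sum_add_distrib, ← Finset.mul_sum] at key
  have hp0 : poch ν 0 = 1 := by simp [poch]
  simp only [hp0, poch_succ ν m, Nat.choose_zero_right, pow_zero] at key ⊢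
  push_cast at key ⊢
  linear_combination key

/-- the Laguerre functions satisfy
`2x ℓ_m'(x) = -ν ℓ_m(x) - m(m-1+ν) ℓ_{m-1}(x) + ℓ_{m+1}(x)`
(for `m = 0` the middle term vanishes, matching the convention `ℓ_{-1} = 0`). -/
theorem laguerre_function_recursion (ν : ℝ) (hν : 0 < ν) (m : ℕ) (x : ℝ) :
    2 * x * deriv (lagFun ν m) x
      = -ν * lagFun ν m x - (m : ℝ) * ((m : ℝ) - 1 + ν) * lagFun ν (m - 1) x
        + lagFun ν (m + 1) x := by
  obtain ⟨D, hD, hyD⟩ := lagPoly_deriv ν m (2 * x)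
  have hr := poly_rec ν hν m (2 * x)
  rw [← hyD] at hr
  have h2 : HasDerivAt (fun x : ℝ => 2 * x) 2 x := by
    simpa using (hasDerivAt_id x).const_mul 2
  have hL : HasDerivAt (fun x : ℝ => lagPoly ν m (2 * x)) (D * 2) x :=
    HasDerivAt.comp x hD h2
  have hE : HasDerivAt (fun x : ℝ => Real.exp (-x)) (Real.exp (-x) * (-1)) x :=
    (hasDerivAt_neg x).exp
  have hF : HasDerivAt (lagFun ν m) _ x := hE.mul hL
  rw [hF.deriv]
  unfold lagFun
  linear_combination Real.exp (-x) * hr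
end

section
/- Let ν > 0 be real and let m ≥ 0 be an integer. For every complex number z with Re z > 0: ∫₀^∞ e^{−zx} ℓ_m^ν(x) x^{ν−1} dx = Γ(m + ν) · (z + 1)^{−ν} · ((z − 1)/(z + 1))^m, where Γ is the Gamma function and the power (z+1)^{−ν} uses the principal branch. -/
open Real MeasureTheory

/-- Real integrability of the Gamma-type integrand. -/
lemma aux_int_real {a b : ℝ} (ha : 0 < a) (hb : 0 < b) :
    IntegrableOn (fun x : ℝ => Real.exp (-b * x) * x ^ (a - 1)) (Set.Ioi 0) := by
  have h := integrableOn_rpow_mul_exp_neg_mul_rpow (p := 1) (s := a - 1) (b := b)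
    (by linarith) one_pos hb
  refine h.congr_fun (fun x _ => ?_) measurableSet_Ioi
  simp only [Real.rpow_one]
  ring

lemma aux_meas_s18 (a : ℝ) (w : ℂ) :
    AEStronglyMeasurable (fun x : ℝ => Complex.exp (-w * (x : ℂ)) * ((x ^ (a - 1) : ℝ) : ℂ))
      (volume.restrict (Set.Ioi 0)) := by
  apply Measurable.aestronglyMeasurable
  fun_prop

lemma aux_norm (a : ℝ) (w : ℂ) {x : ℝ} (hx : 0 < x) :
    ‖Complex.exp (-w * (x : ℂ)) * ((x ^ (a - 1) : ℝ) : ℂ)‖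
      = Real.exp (-w.re * x) * x ^ (a - 1) := by
  rw [norm_mul, Complex.norm_exp, Complex.norm_real, Real.norm_eq_abs,
    abs_of_pos (Real.rpow_pos_of_pos hx _)]
  simp

lemma aux_int_s18 {a : ℝ} (ha : 0 < a) {w : ℂ} (hw : 0 < w.re) :
    IntegrableOn (fun x : ℝ => Complex.exp (-w * (x : ℂ)) * ((x ^ (a - 1) : ℝ) : ℂ))
      (Set.Ioi 0) := by
  refine Integrable.mono' (aux_int_real ha hw) (aux_meas_s18 a w) ?_
  filter_upwards [ae_restrict_mem measurableSet_Ioi] with x hx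
  exact (aux_norm a w hx).le

lemma aux_diff {a : ℝ} (ha : 0 < a) {w : ℂ} (hw : 0 < w.re) :
    DifferentiableAt ℂ (fun w : ℂ => ∫ x in Set.Ioi (0 : ℝ),
      Complex.exp (-w * (x : ℂ)) * ((x ^ (a - 1) : ℝ) : ℂ)) w := by
  have hs : {u : ℂ | w.re / 2 < u.re} ∈ nhds w :=
    (isOpen_lt continuous_const Complex.continuous_re).mem_nhds (by simp; linarith)
  refine (hasDerivAt_integral_of_dominated_loc_of_deriv_le (𝕜 := ℂ)
    (F := fun (w : ℂ) (x : ℝ) => Complex.exp (-w * (x : ℂ)) * ((x ^ (a - 1) : ℝ) : ℂ))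
    (F' := fun (w : ℂ) (x : ℝ) =>
      (Complex.exp (-w * (x : ℂ)) * (-(x : ℂ))) * ((x ^ (a - 1) : ℝ) : ℂ))
    (bound := fun x : ℝ => Real.exp (-(w.re / 2) * x) * x ^ (a + 1 - 1))
    hs (Filter.Eventually.of_forall fun u => aux_meas_s18 a u) (aux_int_s18 ha hw) ?_ ?_
    (aux_int_real (by linarith) (by linarith)) ?_).2.differentiableAt
  · apply Measurable.aestronglyMeasurable
    fun_prop
  · filter_upwards [ae_restrict_mem measurableSet_Ioi] with x hx u hu
    have hx : 0 < x := hx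
    have hu : w.re / 2 < u.re := hu
    have e : Complex.exp (-u * (x : ℂ)) * (-(x : ℂ)) * ((x ^ (a - 1) : ℝ) : ℂ)
        = (-(x : ℂ)) * (Complex.exp (-u * (x : ℂ)) * ((x ^ (a - 1) : ℝ) : ℂ)) := by ring
    rw [e, norm_mul, aux_norm a u hx, norm_neg, Complex.norm_real, Real.norm_eq_abs,
      abs_of_pos hx]
    have e2 : x ^ (a + 1 - 1) = x * x ^ (a - 1) := by
      rw [show a + 1 - 1 = (a - 1) + 1 by ring, Real.rpow_add_one hx.ne']; ring
    rw [e2]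
    have h1 : Real.exp (-u.re * x) ≤ Real.exp (-(w.re / 2) * x) := by
      apply Real.exp_le_exp.2; nlinarith
    have h2 : 0 ≤ x * x ^ (a - 1) := by positivity
    nlinarith
  · filter_upwards with x u _
    have h : HasDerivAt (fun u : ℂ => -u * (x : ℂ)) (-(x : ℂ)) u := by
      simpa using ((hasDerivAt_id u).neg.mul_const (x : ℂ))
    exact h.cexp.mul_const _

/-- The Gamma integral with a complex parameter. -/
lemma aux_gamma_s18 {a : ℝ} (ha : 0 < a) {w : ℂ} (hw : 0 < w.re) :
    ∫ x in Set.Ioi (0 : ℝ), Complex.exp (-w * (x : ℂ)) * ((x ^ (a - 1) : ℝ) : ℂ)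
      = (Real.Gamma a : ℂ) * w ^ (-(a : ℂ)) := by
  set U : Set ℂ := {u : ℂ | 0 < u.re} with hU
  have hUo : IsOpen U := isOpen_lt continuous_const Complex.continuous_re
  have hUc : IsPreconnected U := (convex_halfSpace_re_gt 0).isPreconnected
  have h1 : AnalyticOnNhd ℂ (fun w : ℂ => ∫ x in Set.Ioi (0 : ℝ),
      Complex.exp (-w * (x : ℂ)) * ((x ^ (a - 1) : ℝ) : ℂ)) U :=
    DifferentiableOn.analyticOnNhd
      (fun u hu => (aux_diff ha hu).differentiableWithinAt) hUo
  have h2 : AnalyticOnNhd ℂ (fun w : ℂ => (Real.Gamma a : ℂ) * w ^ (-(a : ℂ))) U := by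
    refine DifferentiableOn.analyticOnNhd (fun u hu => ?_) hUo
    have : u ∈ Complex.slitPlane := Or.inl hu
    exact (((hasDerivAt_id u).cpow_const (c := -(a : ℂ)) this).differentiableAt.const_mul
      _).differentiableWithinAt
  have h3 : ∀ r : ℝ, 0 < r → (∫ x in Set.Ioi (0 : ℝ),
      Complex.exp (-(r : ℂ) * (x : ℂ)) * ((x ^ (a - 1) : ℝ) : ℂ))
        = (Real.Gamma a : ℂ) * (r : ℂ) ^ (-(a : ℂ)) := by
    intro r hr
    have h := Real.integral_rpow_mul_exp_neg_mul_Ioi ha hr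
    have e : ∀ x : ℝ, Complex.exp (-(r : ℂ) * (x : ℂ)) * ((x ^ (a - 1) : ℝ) : ℂ)
        = ((x ^ (a - 1) * Real.exp (-(r * x)) : ℝ) : ℂ) := by
      intro x
      push_cast
      rw [mul_comm, neg_mul]
    simp_rw [e]
    rw [integral_complex_ofReal, h, one_div, Real.inv_rpow hr.le, ← Real.rpow_neg hr.le,
      Complex.ofReal_mul, Complex.ofReal_cpow hr.le, mul_comm]
    simp
  have h4 : Filter.Tendsto (fun r : ℝ => (r : ℂ)) (nhdsWithin 1 {1}ᶜ)
      (nhdsWithin (1 : ℂ) {1}ᶜ) := by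
    refine tendsto_nhdsWithin_iff.2 ⟨?_, ?_⟩
    · have : Filter.Tendsto (fun r : ℝ => (r : ℂ)) (nhds 1) (nhds ((1 : ℝ) : ℂ)) :=
        Complex.continuous_ofReal.tendsto 1
      simpa using this.mono_left nhdsWithin_le_nhds
    · filter_upwards [self_mem_nhdsWithin] with r hr
      simpa using hr
  refine h1.eqOn_of_preconnected_of_frequently_eq h2 hUc (z₀ := 1) (by simp [hU]) ?_ hw
  refine h4.frequently (Filter.Eventually.frequently ?_)
  have : ∀ᶠ r : ℝ in nhdsWithin 1 {1}ᶜ, 0 < r :=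
    nhdsWithin_le_nhds (lt_mem_nhds one_pos)
  filter_upwards [this] with r hr
  exact h3 r hr

lemma poch_pos {ν : ℝ} (hν : 0 < ν) (k : ℕ) : 0 < poch ν k :=
  Finset.prod_pos fun i _ => by positivity

lemma gamma_poch {ν : ℝ} (hν : 0 < ν) (k : ℕ) :
    Real.Gamma (ν + k) = poch ν k * Real.Gamma ν := by
  induction k with
  | zero => simp [poch]
  | succ k ih =>
    have : ν + ((k + 1 : ℕ) : ℝ) = (ν + k) + 1 := by push_cast; ring
    rw [this, Real.Gamma_add_one (by positivity), ih]
    simp only [poch, Finset.prod_range_succ]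
    ring

/-- the Laplace transform of the Laguerre function:
`∫₀^∞ e^{-zx} ℓ_m^ν(x) x^{ν-1} dx = Γ(m+ν) (z+1)^{-ν} ((z-1)/(z+1))^m` for `Re z > 0`. -/
theorem laplace_transform_laguerre (ν : ℝ) (hν : 0 < ν) (m : ℕ)
    (z : ℂ) (hz : 0 < z.re) :
    (∫ x in Set.Ioi (0 : ℝ),
        Complex.exp (-z * (x : ℂ)) * (lagFun ν m x : ℂ) * ((x ^ (ν - 1) : ℝ) : ℂ))
      = (Real.Gamma ((m : ℝ) + ν) : ℂ) * (z + 1) ^ (-(ν : ℂ)) *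
          ((z - 1) / (z + 1)) ^ m := by
  have hw : 0 < (z + 1).re := by simp; linarith
  have hw0 : z + 1 ≠ 0 := fun h => by simp [h] at hw
  have hint : ∀ x ∈ Set.Ioi (0 : ℝ),
      Complex.exp (-z * (x : ℂ)) * (lagFun ν m x : ℂ) * ((x ^ (ν - 1) : ℝ) : ℂ)
      = ∑ n ∈ Finset.range (m + 1),
        (((m.choose n : ℝ) * (poch ν m / poch ν n) * (-2) ^ n : ℝ) : ℂ) *
          (Complex.exp (-(z + 1) * (x : ℂ)) * ((x ^ ((ν + n) - 1) : ℝ) : ℂ)) := by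
    intro x hx
    have hx : 0 < x := hx
    have e1 : Complex.exp (-(z + 1) * (x : ℂ))
        = Complex.exp (-z * (x : ℂ)) * Complex.exp (-(x : ℂ)) := by
      rw [← Complex.exp_add]; congr 1; ring
    rw [e1, lagFun, lagPoly, Complex.ofReal_mul, Complex.ofReal_sum, Finset.mul_sum,
      Finset.mul_sum, Finset.sum_mul]
    refine Finset.sum_congr rfl fun n _ => ?_
    have e2 : x ^ ((ν + n) - 1) = x ^ (ν - 1) * x ^ n := by
      rw [show (ν + n) - 1 = (ν - 1) + n by ring, Real.rpow_add_natCast hx.ne']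
    rw [e2, show -(2 * x) = (-2) * x by ring, mul_pow]
    push_cast
    ring
  rw [setIntegral_congr_fun measurableSet_Ioi hint, integral_finsetSum _ fun (n : ℕ) _ =>
    (aux_int_s18 (a := ν + (n : ℝ)) (by positivity) hw).const_mul _]
  have hterm : ∀ n ∈ Finset.range (m + 1),
      (∫ x in Set.Ioi (0 : ℝ),
        (((m.choose n : ℝ) * (poch ν m / poch ν n) * (-2) ^ n : ℝ) : ℂ) *
          (Complex.exp (-(z + 1) * (x : ℂ)) * ((x ^ ((ν + n) - 1) : ℝ) : ℂ)))
      = (Real.Gamma ((m : ℝ) + ν) : ℂ) * (z + 1) ^ (-(ν : ℂ)) *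
        ((-2 / (z + 1)) ^ n * 1 ^ (m - n) * (m.choose n : ℂ)) := by
    intro n _
    rw [integral_const_mul, aux_gamma_s18 (a := ν + n) (by positivity) hw]
    have hp : (poch ν n : ℂ) ≠ 0 := by exact_mod_cast (poch_pos hν n).ne'
    have e3 : (z + 1) ^ (-((ν + n : ℝ) : ℂ)) = (z + 1) ^ (-(ν : ℂ)) / (z + 1) ^ n := by
      rw [← Complex.cpow_natCast (z + 1) n, ← Complex.cpow_sub _ _ hw0]
      congr 1
      push_cast
      ring
    rw [e3, add_comm (m : ℝ) ν, gamma_poch hν n, gamma_poch hν m, div_pow]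
    push_cast
    field_simp
    try simp
  rw [Finset.sum_congr rfl hterm, ← Finset.mul_sum, ← add_pow]
  congr 2
  field_simp
  ring
end
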